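/- Let F := (z₂ − 2)² − (z₁ − 1)(z₁⁵ + 2z₁ + 5)² ∈ ℂ[z₁,z₂]. For generic (a₁, a₂, b, u₁, u₂, u₃) ∈ ℂ⁶, writing ℓ(z) := a₁z₁ + a₂z₂ + b, the set {z ∈ (ℂ*)² : F(z) = 0, ℓ(z) ≠ 0, and there exists λ ∈ ℂ with u_i/z_i + u₃·a_i/ℓ(z) = λ·(∂F/∂z_i)(z) for i = 1,2} has exactly 23 elements. (The first removal ML degree of the hyperelliptic curve (y−2)² = (x−1)(x⁵+2x+5)² is r₁ = 23.) -/

import Mathlib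

open MvPolynomial

/-- The hyperelliptic curve `(y − 2)² = (x − 1)(x⁵ + 2x + 5)²`. -/
noncomputable def hyperF : MvPolynomial (Fin 2) ℂ :=
  (X 1 - 2) ^ 2 - (X 0 - 1) * (X 0 ^ 5 + 2 * X 0 + 5) ^ 2

namespace HyperellipticRemoval

section Generic

variable {σ : Type*}

/-- A property of points of affine space over `ℂ` that holds off a proper hypersurface. -/
def Generic (P : (σ → ℂ) → Prop) : Prop :=
  ∃ g : MvPolynomial σ ℂ, g ≠ 0 ∧ ∀ w, eval w g ≠ 0 → P w

theorem Generic.and {P Q : (σ → ℂ) → Prop} (hP : Generic P) (hQ : Generic Q) :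
    Generic fun w => P w ∧ Q w := by
  obtain ⟨g, hg, hgP⟩ := hP
  obtain ⟨h, hh, hhQ⟩ := hQ
  refine ⟨g * h, mul_ne_zero hg hh, fun w hw => ?_⟩
  rw [map_mul] at hw
  exact ⟨hgP w (left_ne_zero_of_mul hw), hhQ w (right_ne_zero_of_mul hw)⟩

theorem Generic.mono {P Q : (σ → ℂ) → Prop} (hP : Generic P) (h : ∀ w, P w → Q w) :
    Generic Q := by
  obtain ⟨g, hg, hgP⟩ := hP
  exact ⟨g, hg, fun w hw => h w (hgP w hw)⟩

theorem Generic.forall_mem {ι : Type*} {P : ι → (σ → ℂ) → Prop} (s : Finset ι)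
    (hP : ∀ i ∈ s, Generic (P i)) : Generic fun w => ∀ i ∈ s, P i w := by
  classical
  induction s using Finset.induction_on with
  | empty => exact ⟨1, one_ne_zero, by simp⟩
  | insert a s ha ih =>
    refine ((hP a (by simp)).and (ih fun i hi => hP i (by simp [hi]))).mono fun w hw => ?_
    simpa using hw

theorem generic_eval_ne_zero (f : MvPolynomial σ ℂ) (w₀ : σ → ℂ) (h : eval w₀ f ≠ 0) :
    Generic fun w => eval w f ≠ 0 :=
  ⟨f, fun hf => h (by simp [hf]), fun _ hw => hw⟩

/-- If one member of a polynomial family is separable of the maximal degree, so is the generic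
member. -/
theorem generic_separable (P : Polynomial (MvPolynomial σ ℂ)) {d : ℕ} (hd : d ≠ 0)
    (hP : P.natDegree ≤ d) (w₀ : σ → ℂ) (hdeg : (P.map (eval w₀)).natDegree = d)
    (hsep : (P.map (eval w₀)).Separable) :
    Generic fun w => (P.map (eval w)).Separable ∧ (P.map (eval w)).natDegree = d := by
  have hP' : P.derivative.natDegree ≤ d - 1 :=
    (Polynomial.natDegree_derivative_le P).trans (Nat.sub_le_sub_right hP 1)
  obtain ⟨p, q, -, -, hpq⟩ :=
    Polynomial.exists_mul_add_mul_eq_C_resultant P P.derivative hP hP' (Or.inl hd)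
  refine ((generic_eval_ne_zero (P.resultant P.derivative d (d - 1)) w₀ ?_).and
    (generic_eval_ne_zero (P.coeff d) w₀ ?_)).mono fun w hw => ⟨?_, ?_⟩
  · rw [← Polynomial.resultant_map_map, ← Polynomial.derivative_map]
    have := Polynomial.resultant_ne_zero _ _ hsep
    rwa [Polynomial.natDegree_derivative, hdeg] at this
  · rw [← Polynomial.coeff_map, ← hdeg]
    exact Polynomial.leadingCoeff_ne_zero.mpr hsep.ne_zero
  · have key := congrArg (Polynomial.map (eval w)) hpq
    rw [Polynomial.map_add, Polynomial.map_mul, Polynomial.map_mul, Polynomial.map_C,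
      ← Polynomial.derivative_map] at key
    set r := eval w (P.resultant P.derivative d (d - 1)) with hr
    refine ⟨Polynomial.C r⁻¹ * p.map (eval w), Polynomial.C r⁻¹ * q.map (eval w), ?_⟩
    have hC : Polynomial.C r⁻¹ * Polynomial.C r = 1 := by
      rw [← Polynomial.C_mul, inv_mul_cancel₀ hw.1, Polynomial.C_1]
    linear_combination Polynomial.C r⁻¹ * key + hC
  · refine le_antisymm (Polynomial.natDegree_map_le.trans hP)
      (Polynomial.le_natDegree_of_ne_zero ?_)
    rw [Polynomial.coeff_map]
    exact hw.2

end Generic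

theorem isCoprime_of_forall_eval {p q : Polynomial ℂ}
    (h : ∀ t, p.eval t = 0 → q.eval t ≠ 0) : IsCoprime p q := by
  refine (Polynomial.isCoprime_iff_aeval_ne_zero_of_isAlgClosed ℂ ℂ p q).mpr fun t => ?_
  simpa [or_iff_not_imp_left] using h t

section Parametrization

variable {R S : Type*} [CommRing R] [CommRing S]

variable (R) in
/-- The first coordinate of the parametrization of the curve, as a polynomial in the parameter. -/
noncomputable def curveX : Polynomial R := Polynomial.X ^ 2 + 1

variable (R) in
/-- The second coordinate of the parametrization of the curve. -/
noncomputable def curveY : Polynomial R :=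
  Polynomial.X ^ 11 + 5 * Polynomial.X ^ 9 + 10 * Polynomial.X ^ 7 + 10 * Polynomial.X ^ 5 +
    7 * Polynomial.X ^ 3 + 8 * Polynomial.X + 2

/-- The affine-linear form with coefficients `w 0, w 1, w 2`, restricted to the curve. -/
noncomputable def line (w : Fin 6 → R) : Polynomial R :=
  Polynomial.C (w 0) * curveX R + Polynomial.C (w 1) * curveY R + Polynomial.C (w 2)

/-- The numerator of the logarithmic derivative of `x ^ u₁ * y ^ u₂ * ℓ ^ u₃` along the curve. -/
noncomputable def critPoly (w : Fin 6 → R) : Polynomial R :=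
  Polynomial.C (w 3) * (curveX R).derivative * curveY R * line w +
    Polynomial.C (w 4) * curveX R * (curveY R).derivative * line w +
    Polynomial.C (w 5) * curveX R * curveY R * (line w).derivative

theorem derivative_curveX : (curveX R).derivative = 2 * Polynomial.X := by
  simp only [curveX, Polynomial.derivative_add, Polynomial.derivative_X_pow,
    Polynomial.derivative_one, Nat.cast_ofNat, map_ofNat]
  ring

theorem derivative_curveY : (curveY R).derivative =
    11 * Polynomial.X ^ 10 + 45 * Polynomial.X ^ 8 + 70 * Polynomial.X ^ 6 +
      50 * Polynomial.X ^ 4 + 21 * Polynomial.X ^ 2 + 8 := by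
  simp only [curveY, Polynomial.derivative_add, Polynomial.derivative_mul,
    Polynomial.derivative_X_pow, Polynomial.derivative_X, Polynomial.derivative_ofNat,
    Nat.cast_ofNat, map_ofNat]
  ring

theorem derivative_line (w : Fin 6 → R) : (line w).derivative =
    Polynomial.C (w 0) * (curveX R).derivative + Polynomial.C (w 1) * (curveY R).derivative := by
  simp [line]

theorem map_curveX (f : R →+* S) : (curveX R).map f = curveX S := by
  simp [curveX]

theorem map_curveY (f : R →+* S) : (curveY R).map f = curveY S := by
  simp [curveY]

theorem map_line (f : R →+* S) (w : Fin 6 → R) : (line w).map f = line (f ∘ w) := by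
  simp [line, map_curveX, map_curveY]

theorem map_critPoly (f : R →+* S) (w : Fin 6 → R) :
    (critPoly w).map f = critPoly (f ∘ w) := by
  simp only [critPoly, Polynomial.map_add, Polynomial.map_mul, Polynomial.map_C,
    ← Polynomial.derivative_map, map_curveX, map_curveY, map_line, Function.comp_apply]

theorem natDegree_curveX_le : (curveX R).natDegree ≤ 2 := by
  unfold curveX; compute_degree

theorem natDegree_curveY_le : (curveY R).natDegree ≤ 11 := by
  unfold curveY; compute_degree

theorem natDegree_line_le (w : Fin 6 → R) : (line w).natDegree ≤ 11 := by
  unfold line curveX curveY; compute_degree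

theorem natDegree_critPoly_le (w : Fin 6 → R) : (critPoly w).natDegree ≤ 23 := by
  have hx := natDegree_curveX_le (R := R)
  have hy := natDegree_curveY_le (R := R)
  have hl := natDegree_line_le w
  have hx' := (Polynomial.natDegree_derivative_le (curveX R)).trans (Nat.sub_le_sub_right hx 1)
  have hy' := (Polynomial.natDegree_derivative_le (curveY R)).trans (Nat.sub_le_sub_right hy 1)
  have hl' := (Polynomial.natDegree_derivative_le (line w)).trans (Nat.sub_le_sub_right hl 1)
  refine Polynomial.natDegree_add_le_of_degree_le (Polynomial.natDegree_add_le_of_degree_le ?_ ?_) ?_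
  · exact Polynomial.natDegree_mul_le_of_le (Polynomial.natDegree_mul_le_of_le
      ((Polynomial.natDegree_C_mul_le _ _).trans hx') hy) hl
  · exact Polynomial.natDegree_mul_le_of_le (Polynomial.natDegree_mul_le_of_le
      ((Polynomial.natDegree_C_mul_le _ _).trans hx) hy') hl
  · exact Polynomial.natDegree_mul_le_of_le (Polynomial.natDegree_mul_le_of_le
      ((Polynomial.natDegree_C_mul_le _ _).trans hx) hy) hl'

end Parametrization

section Complex

theorem eval_curveX (t : ℂ) : (curveX ℂ).eval t = t ^ 2 + 1 := by
  simp [curveX]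

theorem eval_curveY (t : ℂ) : (curveY ℂ).eval t =
    t ^ 11 + 5 * t ^ 9 + 10 * t ^ 7 + 10 * t ^ 5 + 7 * t ^ 3 + 8 * t + 2 := by
  simp [curveY]

theorem eval_derivative_curveX (t : ℂ) : (curveX ℂ).derivative.eval t = 2 * t := by
  simp [derivative_curveX]

theorem eval_derivative_curveY (t : ℂ) : (curveY ℂ).derivative.eval t =
    11 * t ^ 10 + 45 * t ^ 8 + 70 * t ^ 6 + 50 * t ^ 4 + 21 * t ^ 2 + 8 := by
  simp [derivative_curveY]

theorem eval_line (w : Fin 6 → ℂ) (t : ℂ) : (line w).eval t =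
    w 0 * (curveX ℂ).eval t + w 1 * (curveY ℂ).eval t + w 2 := by
  simp [line]

theorem eval_critPoly (w : Fin 6 → ℂ) (t : ℂ) : (critPoly w).eval t =
    w 3 * (curveX ℂ).derivative.eval t * (curveY ℂ).eval t * (line w).eval t +
      w 4 * (curveX ℂ).eval t * (curveY ℂ).derivative.eval t * (line w).eval t +
      w 5 * (curveX ℂ).eval t * (curveY ℂ).eval t * (line w).derivative.eval t := by
  simp [critPoly]

theorem eval_derivative_line (w : Fin 6 → ℂ) (t : ℂ) : (line w).derivative.eval t =
    w 0 * (curveX ℂ).derivative.eval t + w 1 * (curveY ℂ).derivative.eval t := by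
  simp [derivative_line]

theorem separable_curveX : (curveX ℂ).Separable := by
  refine isCoprime_of_forall_eval fun t h h' => ?_
  rw [eval_curveX] at h
  rw [eval_derivative_curveX] at h'
  have : (1 : ℂ) = 0 := by linear_combination h - t / 2 * h'
  norm_num at this

theorem separable_curveY : (curveY ℂ).Separable := by
  refine isCoprime_of_forall_eval fun t h h' => ?_
  rw [eval_curveY] at h
  rw [eval_derivative_curveY] at h'
  have : (7933963571368658 : ℂ) = 0 := by
    linear_combination (980974589412593 - 3092104774804104 * t + 1286835164512061 * t ^ 2
      - 5476282492869022 * t ^ 3 + 1438768400087613 * t ^ 4 - 6776213209664453 * t ^ 5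
      + 766131642881481 * t ^ 6 - 4044725812451044 * t ^ 7 + 171789314943499 * t ^ 8
      - 947958985432338 * t ^ 9) * h +
      (746501799067934 - 207948395711567 * t + 810828761122762 * t ^ 2
      - 230252768287961 * t ^ 3 + 1028120328678872 * t ^ 4 - 192823113432103 * t ^ 5
      + 943172087065883 * t ^ 6 - 83845795215961 * t ^ 7 + 446046064390784 * t ^ 8
      - 15617210449409 * t ^ 9 + 86178089584758 * t ^ 10) * h'
  norm_num at this

theorem separable_derivative_curveY : (curveY ℂ).derivative.Separable := by
  refine isCoprime_of_forall_eval fun t h h' => ?_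
  rw [eval_derivative_curveY] at h
  have h'' : 110 * t ^ 9 + 360 * t ^ 7 + 420 * t ^ 5 + 200 * t ^ 3 + 42 * t = 0 := by
    rw [derivative_curveY] at h'
    simp at h'
    linear_combination h'
  have : (41331236176 : ℂ) = 0 := by
    linear_combination (5166404522 - 2100247800 * t ^ 2 + 38097430020 * t ^ 4
      + 84567237160 * t ^ 6 + 47761080510 * t ^ 8) * h +
      (-2183155061 * t - 1961034530 * t ^ 3 - 10097329110 * t ^ 5 - 12364448485 * t ^ 7
      - 4776108051 * t ^ 9) * h''
  norm_num at this

theorem eval_curveY_ne_zero_of_curveX {t : ℂ} (h : (curveX ℂ).eval t = 0) :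
    (curveY ℂ).eval t ≠ 0 := by
  intro h'
  rw [eval_curveX] at h
  rw [eval_curveY] at h'
  have h5 : 5 * t + 2 = 0 := by
    linear_combination h' - (t ^ 9 + 4 * t ^ 7 + 6 * t ^ 5 + 4 * t ^ 3 + 3 * t) * h
  have : (29 : ℂ) = 0 := by linear_combination 25 * h - (5 * t - 2) * h5
  norm_num at this

theorem isCoprime_curveX_curveY : IsCoprime (curveX ℂ) (curveY ℂ) :=
  isCoprime_of_forall_eval fun _ => eval_curveY_ne_zero_of_curveX

theorem isCoprime_curveX_derivative_curveY :
    IsCoprime (curveX ℂ) (curveY ℂ).derivative := by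
  refine isCoprime_of_forall_eval fun t h h' => ?_
  rw [eval_curveX] at h
  rw [eval_derivative_curveY] at h'
  have : (1 : ℂ) = 0 := by
    linear_combination h' - (11 * t ^ 8 + 34 * t ^ 6 + 36 * t ^ 4 + 14 * t ^ 2 + 7) * h
  norm_num at this

theorem critPoly_second_coordinate :
    critPoly (![0, 1, 0, 0, 0, 1] : Fin 6 → ℂ) =
      curveX ℂ * curveY ℂ * (curveY ℂ).derivative := by
  simp [critPoly, derivative_line]

theorem line_second_coordinate : line (![0, 1, 0, 0, 0, 1] : Fin 6 → ℂ) = curveY ℂ := by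
  simp [line]

theorem eval_comp_X (w : Fin 6 → ℂ) : (⇑(eval w) ∘ (X : Fin 6 → MvPolynomial (Fin 6) ℂ)) = w := by
  ext i; simp

theorem natDegree_curveY : (curveY ℂ).natDegree = 11 := by
  unfold curveY; compute_degree!

theorem generic_critPoly_separable :
    Generic fun w => (critPoly w).Separable ∧ (critPoly w).natDegree = 23 := by
  have hX : (curveX ℂ).natDegree = 2 := by unfold curveX; compute_degree!
  have hmap (w : Fin 6 → ℂ) :
      (critPoly (X : Fin 6 → MvPolynomial (Fin 6) ℂ)).map (eval w) = critPoly w := by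
    rw [map_critPoly, eval_comp_X]
  have hgen := generic_separable (critPoly (X : Fin 6 → MvPolynomial (Fin 6) ℂ))
    (d := 23) (by norm_num) (natDegree_critPoly_le _) ![0, 1, 0, 0, 0, 1] ?_ ?_
  · simpa only [hmap] using hgen
  · rw [hmap, critPoly_second_coordinate, Polynomial.natDegree_mul
      (mul_ne_zero separable_curveX.ne_zero separable_curveY.ne_zero)
      separable_derivative_curveY.ne_zero, Polynomial.natDegree_mul separable_curveX.ne_zero
      separable_curveY.ne_zero, Polynomial.natDegree_derivative, hX, natDegree_curveY]
  · rw [hmap, critPoly_second_coordinate]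
    exact (separable_curveX.mul separable_curveY isCoprime_curveX_curveY).mul
      separable_derivative_curveY
      (isCoprime_curveX_derivative_curveY.mul_left separable_curveY)

theorem generic_line_separable : Generic fun w => (line w).Separable := by
  have hmap (w : Fin 6 → ℂ) :
      (line (X : Fin 6 → MvPolynomial (Fin 6) ℂ)).map (eval w) = line w := by
    rw [map_line, eval_comp_X]
  have hgen := generic_separable (line (X : Fin 6 → MvPolynomial (Fin 6) ℂ))
    (d := 11) (by norm_num) (natDegree_line_le _) ![0, 1, 0, 0, 0, 1] ?_ ?_
  · simp only [hmap] at hgen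
    exact hgen.mono fun w hw => hw.1
  · rw [hmap, line_second_coordinate, natDegree_curveY]
  · rw [hmap, line_second_coordinate]
    exact separable_curveY

theorem eval_eval_C (P : Polynomial (MvPolynomial (Fin 6) ℂ)) (w : Fin 6 → ℂ) (t : ℂ) :
    eval w (P.eval (C t)) = (P.map (eval w)).eval t := by
  rw [Polynomial.eval_map, ← Polynomial.eval₂_at_apply, eval_C]

/-- The node polynomial of the curve, pulled back to the parameter line. -/
noncomputable def nodePoly : Polynomial ℂ := curveX ℂ ^ 5 + 2 * curveX ℂ + 5

theorem eval_nodePoly (t : ℂ) :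
    nodePoly.eval t = (t ^ 2 + 1) ^ 5 + 2 * (t ^ 2 + 1) + 5 := by
  simp [nodePoly, eval_curveX]

theorem eval_curveY_eq (t : ℂ) : (curveY ℂ).eval t = t * nodePoly.eval t + 2 := by
  rw [eval_curveY, eval_nodePoly]; ring

theorem generic_critPoly_ne_zero {t : ℂ}
    (ht : (curveX ℂ * curveY ℂ * nodePoly).eval t = 0) :
    Generic fun w => (critPoly w).eval t ≠ 0 := by
  suffices h : ∃ w₀ : Fin 6 → ℂ, (critPoly w₀).eval t ≠ 0 by
    obtain ⟨w₀, hw₀⟩ := h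
    have h := generic_eval_ne_zero
      ((critPoly (X : Fin 6 → MvPolynomial (Fin 6) ℂ)).eval (C t)) w₀ (by
        rwa [eval_eval_C, map_critPoly, eval_comp_X])
    simpa only [eval_eval_C, map_critPoly, eval_comp_X] using h
  by_cases hy : (curveY ℂ).eval t = 0
  · refine ⟨![0, 0, 1, 0, 1, 0], ?_⟩
    have hx : (curveX ℂ).eval t ≠ 0 := fun hx => eval_curveY_ne_zero_of_curveX hx hy
    have hy' : (curveY ℂ).derivative.eval t ≠ 0 :=
      separable_curveY.eval₂_derivative_ne_zero (RingHom.id ℂ) hy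
    simp [eval_critPoly, eval_line, hx, hy']
  · refine ⟨![0, 0, 1, 1, 0, 0], ?_⟩
    have ht0 : t ≠ 0 := by
      rintro rfl
      simp [eval_curveX, eval_curveY, eval_nodePoly] at ht
      norm_num at ht
    simp [eval_critPoly, eval_line, eval_derivative_curveX, hy, ht0]

theorem eval_hyperF (z : Fin 2 → ℂ) :
    eval z hyperF = (z 1 - 2) ^ 2 - (z 0 - 1) * (z 0 ^ 5 + 2 * z 0 + 5) ^ 2 := by
  simp [hyperF]

theorem eval_pderiv_zero_hyperF (z : Fin 2 → ℂ) :
    eval z (pderiv 0 hyperF) = -((z 0 ^ 5 + 2 * z 0 + 5) ^ 2 +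
      (z 0 - 1) * (2 * (z 0 ^ 5 + 2 * z 0 + 5) * (5 * z 0 ^ 4 + 2))) := by
  have h2 : pderiv (0 : Fin 2) (2 : MvPolynomial (Fin 2) ℂ) = 0 := pderiv_C
  have h5 : pderiv (0 : Fin 2) (5 : MvPolynomial (Fin 2) ℂ) = 0 := pderiv_C
  simp [hyperF, pderiv_X, h2, h5]
  ring

theorem eval_pderiv_one_hyperF (z : Fin 2 → ℂ) :
    eval z (pderiv 1 hyperF) = 2 * (z 1 - 2) := by
  have h2 : pderiv (1 : Fin 2) (2 : MvPolynomial (Fin 2) ℂ) = 0 := pderiv_C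
  have h5 : pderiv (1 : Fin 2) (5 : MvPolynomial (Fin 2) ℂ) = 0 := pderiv_C
  simp [hyperF, pderiv_X, h2, h5]

/-- The parametrization of the curve by the affine line. -/
noncomputable def curvePoint (t : ℂ) : Fin 2 → ℂ := ![(curveX ℂ).eval t, (curveY ℂ).eval t]

theorem eval_hyperF_curvePoint (t : ℂ) : eval (curvePoint t) hyperF = 0 := by
  simp only [eval_hyperF, curvePoint, Matrix.cons_val_zero, Matrix.cons_val_one, eval_curveX,
    eval_curveY]
  ring

theorem eval_pderiv_zero_curvePoint (t : ℂ) : eval (curvePoint t) (pderiv 0 hyperF) =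
    -(nodePoly.eval t * (curveY ℂ).derivative.eval t) := by
  simp only [eval_pderiv_zero_hyperF, curvePoint, Matrix.cons_val_zero, eval_curveX,
    eval_nodePoly, eval_derivative_curveY]
  ring

theorem eval_pderiv_one_curvePoint (t : ℂ) : eval (curvePoint t) (pderiv 1 hyperF) =
    nodePoly.eval t * (curveX ℂ).derivative.eval t := by
  simp only [eval_pderiv_one_hyperF, curvePoint, Matrix.cons_val_one, eval_curveY_eq,
    eval_derivative_curveX]
  simp
  ring

/-- The parametrization is onto the curve. -/
theorem exists_curvePoint_eq {z : Fin 2 → ℂ} (hz : eval z hyperF = 0) :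
    ∃ t, curvePoint t = z := by
  rw [eval_hyperF] at hz
  suffices h : ∃ t : ℂ, t ^ 2 + 1 = z 0 ∧ t * (z 0 ^ 5 + 2 * z 0 + 5) + 2 = z 1 by
    obtain ⟨t, h0, h1⟩ := h
    refine ⟨t, ?_⟩
    ext i
    fin_cases i
    · simpa [curvePoint, eval_curveX] using h0
    · simpa [curvePoint, eval_curveY_eq, eval_nodePoly, h0] using h1
  by_cases hq : z 0 ^ 5 + 2 * z 0 + 5 = 0
  · obtain ⟨t, ht⟩ := IsAlgClosed.exists_pow_nat_eq (z 0 - 1) (n := 2) (by norm_num)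
    refine ⟨t, by linear_combination ht, ?_⟩
    have h2 : z 1 - 2 = 0 := by
      rw [hq] at hz
      exact pow_eq_zero_iff (n := 2) (by norm_num) |>.mp (by linear_combination hz)
    linear_combination t * hq - h2
  · refine ⟨(z 1 - 2) / (z 0 ^ 5 + 2 * z 0 + 5), ?_, ?_⟩
    · rw [div_pow, div_add_one (pow_ne_zero 2 hq), div_eq_iff (pow_ne_zero 2 hq)]
      linear_combination hz
    · rw [div_mul_cancel₀ _ hq]
      ring

theorem curvePoint_injOn : Set.InjOn curvePoint {t | nodePoly.eval t ≠ 0} := by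
  intro s hs t _ hst
  have h0 : s ^ 2 + 1 = t ^ 2 + 1 := by
    simpa [curvePoint, eval_curveX] using congrFun hst 0
  have h1 : s * nodePoly.eval s + 2 = t * nodePoly.eval t + 2 := by
    simpa [curvePoint, eval_curveY_eq] using congrFun hst 1
  have hn : nodePoly.eval s = nodePoly.eval t := by rw [eval_nodePoly, eval_nodePoly, h0]
  rw [← hn] at h1
  exact mul_right_cancel₀ hs (add_right_cancel h1)

/-- Off the coordinate axes and the line, the critical polynomial is a multiple of the
logarithmic derivative. -/
theorem eval_critPoly_eq (w : Fin 6 → ℂ) {t : ℂ} (hx : (curveX ℂ).eval t ≠ 0)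
    (hy : (curveY ℂ).eval t ≠ 0) (hl : (line w).eval t ≠ 0) :
    (critPoly w).eval t = (curveX ℂ).eval t * (curveY ℂ).eval t * (line w).eval t *
      ((w 3 / (curveX ℂ).eval t + w 5 * w 0 / (line w).eval t) *
          (curveX ℂ).derivative.eval t +
        (w 4 / (curveY ℂ).eval t + w 5 * w 1 / (line w).eval t) *
          (curveY ℂ).derivative.eval t) := by
  rw [eval_critPoly, eval_derivative_line]
  field_simp
  ring

theorem exists_multiplier {A B q x' y' : ℂ} (hq : q ≠ 0) (hxy : x' ≠ 0 ∨ y' ≠ 0)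
    (h : A * x' + B * y' = 0) : ∃ lam : ℂ, A = lam * -(q * y') ∧ B = lam * (q * x') := by
  by_cases hx : x' = 0
  · have hy : y' ≠ 0 := hxy.resolve_left (not_not_intro hx)
    subst hx
    have hB : B = 0 := by simpa [hy] using h
    exact ⟨-A / (q * y'), by field_simp, by simp [hB]⟩
  · refine ⟨B / (q * x'), ?_, by field_simp⟩
    field_simp
    linear_combination h

theorem derivative_ne_zero (t : ℂ) :
    (curveX ℂ).derivative.eval t ≠ 0 ∨ (curveY ℂ).derivative.eval t ≠ 0 := by
  by_cases ht : t = 0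
  · right; simp [ht, eval_derivative_curveY]
  · left; simp [ht, eval_derivative_curveX]

end Complex

end HyperellipticRemoval

open HyperellipticRemoval in
/-- **The first removal ML degree of the hyperelliptic curve
`(y−2)² = (x−1)(x⁵+2x+5)²` is `r₁ = 23`.**  For generic
`(a₁, a₂, b, u₁, u₂, u₃) ∈ ℂ⁶` (encoded as `w 0, …, w 5`), writing
`ℓ(z) = a₁z₁ + a₂z₂ + b`, there are exactly `23` ML-critical points of the curve
with the hyperplane `ℓ` removed. -/
theorem hyperelliptic_removal_ml_degree_one :
    ∃ g : MvPolynomial (Fin 6) ℂ, g ≠ 0 ∧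
      ∀ w : Fin 6 → ℂ, eval w g ≠ 0 →
        {z : Fin 2 → ℂ | (∀ i, z i ≠ 0) ∧ eval z hyperF = 0 ∧
            w 0 * z 0 + w 1 * z 1 + w 2 ≠ 0 ∧
            ∃ lam : ℂ,
              w 3 / z 0 + w 5 * w 0 / (w 0 * z 0 + w 1 * z 1 + w 2)
                = lam * eval z (pderiv 0 hyperF) ∧
              w 4 / z 1 + w 5 * w 1 / (w 0 * z 0 + w 1 * z 1 + w 2)
                = lam * eval z (pderiv 1 hyperF)}.ncard = 23 := by
  have hxyq : curveX ℂ * curveY ℂ * nodePoly ≠ 0 := by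
    refine mul_ne_zero (mul_ne_zero separable_curveX.ne_zero separable_curveY.ne_zero) ?_
    intro h
    have := eval_nodePoly 0
    rw [h] at this
    norm_num at this
  have hgen := generic_critPoly_separable.and (generic_line_separable.and
    ((generic_eval_ne_zero (X 5) 1 (by simp)).and
      (Generic.forall_mem (curveX ℂ * curveY ℂ * nodePoly).roots.toFinset
        fun t ht => generic_critPoly_ne_zero (t := t) (by simpa [hxyq] using ht))))
  refine hgen.mono fun w ⟨⟨hsep, hdeg⟩, hlsep, hw5, hcrit⟩ => ?_
  rw [eval_X] at hw5
  simp only [Multiset.mem_toFinset, Polynomial.mem_roots hxyq, Polynomial.IsRoot.def,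
    Polynomial.eval_mul] at hcrit
  have hx {t : ℂ} (ht : (critPoly w).eval t = 0) : (curveX ℂ).eval t ≠ 0 :=
    fun h => hcrit t (by simp [h]) ht
  have hy {t : ℂ} (ht : (critPoly w).eval t = 0) : (curveY ℂ).eval t ≠ 0 :=
    fun h => hcrit t (by simp [h]) ht
  have hq {t : ℂ} (ht : (critPoly w).eval t = 0) : nodePoly.eval t ≠ 0 :=
    fun h => hcrit t (by simp [h]) ht
  have hl {t : ℂ} (ht : (critPoly w).eval t = 0) : (line w).eval t ≠ 0 := by
    intro h
    have hl' : (line w).derivative.eval t ≠ 0 :=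
      hlsep.eval₂_derivative_ne_zero (RingHom.id ℂ) h
    have ht' := ht
    rw [eval_critPoly, h] at ht'
    simp [hw5, hx ht, hy ht, hl'] at ht'
  have hroots : {t | (critPoly w).eval t = 0}.ncard = 23 := by
    have hset : {t | (critPoly w).eval t = 0} = ((critPoly w).roots.toFinset : Set ℂ) := by
      ext t; simp [hsep.ne_zero]
    rw [hset, Set.ncard_coe_finset, Multiset.toFinset_card_of_nodup
      (Polynomial.nodup_roots hsep), ← (IsAlgClosed.splits _).natDegree_eq_card_roots, hdeg]
  have hinj : Set.InjOn curvePoint {t | (critPoly w).eval t = 0} :=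
    curvePoint_injOn.mono fun t ht => hq ht
  rw [← hroots, ← hinj.ncard_image]
  congr 1
  ext z
  simp only [Set.mem_ofPred_eq, Set.mem_image]
  constructor
  · rintro ⟨hz, hF, hlz, lam, h0, h1⟩
    obtain ⟨t, rfl⟩ := exists_curvePoint_eq hF
    refine ⟨t, ?_, rfl⟩
    rw [eval_pderiv_zero_curvePoint] at h0
    rw [eval_pderiv_one_curvePoint] at h1
    have hzx : (curveX ℂ).eval t ≠ 0 := hz 0
    have hzy : (curveY ℂ).eval t ≠ 0 := hz 1
    simp only [curvePoint, Matrix.cons_val_zero, Matrix.cons_val_one, ← eval_line]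
      at h0 h1 hlz
    rw [eval_critPoly_eq w hzx hzy hlz, h0, h1]
    ring
  · rintro ⟨t, ht, rfl⟩
    have ht' := ht
    rw [eval_critPoly_eq w (hx ht) (hy ht) (hl ht)] at ht'
    obtain ⟨lam, h0, h1⟩ := exists_multiplier (hq ht) (derivative_ne_zero t)
      ((mul_eq_zero.mp ht').resolve_left
        (mul_ne_zero (mul_ne_zero (hx ht) (hy ht)) (hl ht)))
    refine ⟨Fin.forall_fin_two.mpr ⟨hx ht, hy ht⟩, eval_hyperF_curvePoint t, ?_, lam, ?_, ?_⟩
    · simpa only [curvePoint, Matrix.cons_val_zero, Matrix.cons_val_one, ← eval_line] using hl ht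
    · rw [eval_pderiv_zero_curvePoint]
      simpa only [curvePoint, Matrix.cons_val_zero, Matrix.cons_val_one, ← eval_line] using h0
    · rw [eval_pderiv_one_curvePoint]
      simpa only [curvePoint, Matrix.cons_val_zero, Matrix.cons_val_one, ← eval_line] using h1
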